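/- Let w ∈ ℝ^n have all entries strictly positive, b ∈ ℝ, σ : ℝ → ℝ continuous satisfying the STFE property, f(x) = σ(wᵀx + b) on [0,1]^n, ẑ the tie point of σ over [b, wᵀ𝟏 + b], and let h : [0,1]^n → ℝ be h(x) = f(x) if x ∈ R_f and h(x) = σ(b) + ((σ(ẑ)−σ(b))/(ẑ−b))·wᵀx otherwise. Then for every x ∈ R_f ∪ R_l (regions defined with this ẑ), h(x) = conc(f,[0,1]^n)(x). -/

import Mathlib

noncomputable section

/-- `φ` is the concave envelope of `f` over `S`: the pointwise smallest concave
function on `S` that majorizes `f` on `S`. -/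
def IsConcaveEnvelope {E : Type*} [AddCommMonoid E] [Module ℝ E]
    (S : Set E) (f φ : E → ℝ) : Prop :=
  ConcaveOn ℝ S φ ∧ (∀ x ∈ S, f x ≤ φ x) ∧
    ∀ h : E → ℝ, ConcaveOn ℝ S h → (∀ x ∈ S, f x ≤ h x) → ∀ x ∈ S, φ x ≤ h x

/-- `φ` is the convex envelope of `f` over `S`: the pointwise largest convex
function on `S` that minorizes `f` on `S`. -/
def IsConvexEnvelope {E : Type*} [AddCommMonoid E] [Module ℝ E]
    (S : Set E) (f φ : E → ℝ) : Prop :=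
  ConvexOn ℝ S φ ∧ (∀ x ∈ S, φ x ≤ f x) ∧
    ∀ h : E → ℝ, ConvexOn ℝ S h → (∀ x ∈ S, h x ≤ f x) → ∀ x ∈ S, h x ≤ φ x

/-- `zhat ∈ [ℓ,u]` witnesses the secant-then-function form of the concave
envelope of `σ` on `[ℓ,u]`. -/
def STFEwitness (σ : ℝ → ℝ) (ℓ u zhat : ℝ) : Prop :=
  zhat ∈ Set.Icc ℓ u ∧
    IsConcaveEnvelope (Set.Icc ℓ u) σ
      (fun z => if z < zhat then σ ℓ + (σ zhat - σ ℓ) / (zhat - ℓ) * (z - ℓ) else σ z)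

/-- The secant-then-function envelope (STFE) property. -/
def STFE (σ : ℝ → ℝ) : Prop :=
  ∀ ℓ u : ℝ, ℓ ≤ u → ∃ zhat, STFEwitness σ ℓ u zhat

/-- The tie point of `σ` over `[ℓ,u]`: the smallest STFE witness. -/
def IsTiePoint (σ : ℝ → ℝ) (ℓ u zhat : ℝ) : Prop :=
  STFEwitness σ ℓ u zhat ∧ ∀ z, STFEwitness σ ℓ u z → zhat ≤ z

/-- `σ` is S-shaped: convex then concave. -/
def SShaped (σ : ℝ → ℝ) : Prop :=
  ∃ zt : ℝ, ConvexOn ℝ (Set.Iic zt) σ ∧ ConcaveOn ℝ (Set.Ici zt) σ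

/-- The dot product `wᵀx`. -/
def dotp {n : ℕ} (w x : Fin n → ℝ) : ℝ := ∑ i, w i * x i

/-- The region `R_f` of `[0,1]^n`. Note `‖x‖` is the sup norm on `Fin n → ℝ`. -/
def Rf {n : ℕ} (w : Fin n → ℝ) (b zhat : ℝ) : Set (Fin n → ℝ) :=
  {x | x ∈ Set.Icc (0 : Fin n → ℝ) 1 ∧ zhat ≤ dotp w x + b}

/-- The region `R_l` of `[0,1]^n`. -/
def Rl {n : ℕ} (w : Fin n → ℝ) (b zhat : ℝ) : Set (Fin n → ℝ) :=
  {x | x ∈ Set.Icc (0 : Fin n → ℝ) 1 ∧ dotp w x + b < zhat ∧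
    zhat * ‖x‖ ≤ dotp w x + b * ‖x‖}

/-- The region `R_i` of `[0,1]^n`. -/
def Ri {n : ℕ} (w : Fin n → ℝ) (b zhat : ℝ) (i : Fin n) : Set (Fin n → ℝ) :=
  {x | x ∈ Set.Icc (0 : Fin n → ℝ) 1 ∧ dotp w x + b * ‖x‖ < zhat * ‖x‖ ∧
    (∀ j, j < i → x j < x i) ∧ (∀ j, i ≤ j → x j ≤ x i)}

/-- `D'` is a face of the convex set `D`. -/
def IsFace {E : Type*} [AddCommGroup E] [Module ℝ E] (D D' : Set E) : Prop :=
  D' ⊆ D ∧ Convex ℝ D' ∧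
    ∀ x ∈ D, ∀ y ∈ D, ∀ t : ℝ, 0 < t → t < 1 →
      (1 - t) • x + t • y ∈ D' → x ∈ D' ∧ y ∈ D'


theorem dotp_smul {n : ℕ} (w : Fin n → ℝ) (c : ℝ) (x : Fin n → ℝ) :
    dotp w (c • x) = c * dotp w x := by
  simp only [dotp, Pi.smul_apply, smul_eq_mul, Finset.mul_sum]
  exact Finset.sum_congr rfl fun i _ => by ring

theorem dotp_add {n : ℕ} (w x y : Fin n → ℝ) : dotp w (x + y) = dotp w x + dotp w y := by
  simp only [dotp, Pi.add_apply, mul_add, Finset.sum_add_distrib]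

theorem dotp_add_mem_Icc {n : ℕ} {w : Fin n → ℝ} (hw : ∀ i, 0 < w i) (b : ℝ)
    {x : Fin n → ℝ} (hx : x ∈ Set.Icc (0 : Fin n → ℝ) 1) :
    dotp w x + b ∈ Set.Icc b ((∑ i, w i) + b) := by
  have h0 : 0 ≤ dotp w x := Finset.sum_nonneg fun i _ => mul_nonneg (hw i).le (hx.1 i)
  have h1 : dotp w x ≤ ∑ i, w i :=
    Finset.sum_le_sum fun i _ => mul_le_of_le_one_right (hw i).le (hx.2 i)
  exact ⟨by linarith, by linarith⟩

/-- Composing a concave function of one variable with `x ↦ wᵀx + b` is concave on the cube. -/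
theorem ConcaveOn.comp_dotp_add {n : ℕ} {w : Fin n → ℝ} (hw : ∀ i, 0 < w i) (b : ℝ)
    {g : ℝ → ℝ} (hg : ConcaveOn ℝ (Set.Icc b ((∑ i, w i) + b)) g) :
    ConcaveOn ℝ (Set.Icc (0 : Fin n → ℝ) 1) (fun x => g (dotp w x + b)) := by
  refine ⟨convex_Icc 0 1, fun x hx y hy s t hs ht hst => ?_⟩
  have key := hg.2 (dotp_add_mem_Icc hw b hx) (dotp_add_mem_Icc hw b hy) hs ht hst
  have e : s • (dotp w x + b) + t • (dotp w y + b) = dotp w (s • x + t • y) + b := by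
    rw [dotp_add, dotp_smul, dotp_smul, smul_eq_mul, smul_eq_mul]
    linear_combination b * hst
  rwa [e] at key

/-- A concave function on the cube that majorizes `σ (wᵀx + b)` lies above the secant of `σ`
between `b` and `zhat` on the region `Rl`. -/
theorem secant_le_of_mem_Rl {n : ℕ} {w : Fin n → ℝ} (hw : ∀ i, 0 < w i) {b zhat : ℝ}
    {σ : ℝ → ℝ} {φ : (Fin n → ℝ) → ℝ} (hφ : ConcaveOn ℝ (Set.Icc (0 : Fin n → ℝ) 1) φ)
    (hle : ∀ x ∈ Set.Icc (0 : Fin n → ℝ) 1, σ (dotp w x + b) ≤ φ x)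
    {x : Fin n → ℝ} (hx : x ∈ Rl w b zhat) :
    σ b + (σ zhat - σ b) / (zhat - b) * dotp w x ≤ φ x := by
  obtain ⟨hx, hlt, hnorm⟩ := hx
  have hd : 0 ≤ dotp w x := by linarith [(dotp_add_mem_Icc hw b hx).1]
  have hpos : 0 < zhat - b := by linarith
  have h0mem : (0 : Fin n → ℝ) ∈ Set.Icc (0 : Fin n → ℝ) 1 := ⟨le_rfl, zero_le_one⟩
  have hφ0 : σ b ≤ φ 0 := by simpa [dotp] using hle 0 h0mem
  obtain ⟨t, ht⟩ : ∃ t, t = dotp w x / (zhat - b) := ⟨_, rfl⟩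
  have htd : t * (zhat - b) = dotp w x := by rw [ht]; field_simp
  have hxt : ‖x‖ ≤ t := by rw [ht, le_div_iff₀ hpos]; linarith
  have hsec : σ b + (σ zhat - σ b) / (zhat - b) * dotp w x = (1 - t) * σ b + t * σ zhat := by
    rw [ht]; ring
  rw [hsec]
  rcases ((norm_nonneg x).trans hxt).eq_or_lt with ht0 | ht0
  · have hx0 : x = 0 := norm_le_zero_iff.mp (ht0 ▸ hxt)
    rw [← ht0, hx0]
    linarith
  · have ht1 : t ≤ 1 := by rw [ht, div_le_one hpos]; linarith
    have hy : t⁻¹ • x ∈ Set.Icc (0 : Fin n → ℝ) 1 := by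
      refine ⟨smul_nonneg (inv_nonneg.mpr ht0.le) hx.1, fun i => ?_⟩
      have hi : x i ≤ t := (le_abs_self _).trans ((norm_le_pi_norm x i).trans hxt)
      simp only [Pi.smul_apply, smul_eq_mul, Pi.one_apply]
      rwa [inv_mul_le_iff₀ ht0, mul_one]
    have hφy : σ zhat ≤ φ (t⁻¹ • x) := by
      have e : dotp w (t⁻¹ • x) + b = zhat := by
        rw [dotp_smul, ← htd, inv_mul_cancel_left₀ ht0.ne']
        ring
      simpa only [e] using hle _ hy
    have key := hφ.2 h0mem hy (sub_nonneg.mpr ht1) ht0.le (by ring)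
    rw [smul_zero, zero_add, smul_inv_smul₀ ht0.ne', smul_eq_mul, smul_eq_mul] at key
    linarith [mul_le_mul_of_nonneg_left hφ0 (sub_nonneg.mpr ht1),
      mul_le_mul_of_nonneg_left hφy ht0.le]

theorem stmt7 {n : ℕ} (w : Fin n → ℝ) (hw : ∀ i, 0 < w i) (b : ℝ)
    (σ : ℝ → ℝ) (hσ : Continuous σ) (hSTFE : STFE σ)
    (zhat : ℝ) (htie : IsTiePoint σ b ((∑ i, w i) + b) zhat)
    (h : (Fin n → ℝ) → ℝ)
    (hh : ∀ x, h x = if zhat ≤ dotp w x + b then σ (dotp w x + b)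
      else σ b + (σ zhat - σ b) / (zhat - b) * dotp w x)
    (φ : (Fin n → ℝ) → ℝ)
    (hφ : IsConcaveEnvelope (Set.Icc 0 1) (fun x => σ (dotp w x + b)) φ) :
    ∀ x ∈ Rf w b zhat ∪ Rl w b zhat, h x = φ x := by
  obtain ⟨⟨-, hconc, hmaj, -⟩, -⟩ := htie
  obtain ⟨hφconc, hφmaj, hφmin⟩ := hφ
  have hupper : ∀ x ∈ Set.Icc (0 : Fin n → ℝ) 1, φ x ≤ h x := by
    intro x hx
    have key := hφmin _ (hconc.comp_dotp_add hw b)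
      (fun y hy => hmaj _ (dotp_add_mem_Icc hw b hy)) x hx
    rw [hh]
    by_cases hz : zhat ≤ dotp w x + b
    · simpa [hz, not_lt.mpr hz] using key
    · simpa [hz, not_le.mp hz] using key
  rintro x (hx | hx)
  · refine le_antisymm ?_ (hupper x hx.1)
    rw [hh, if_pos hx.2]
    exact hφmaj x hx.1
  · refine le_antisymm ?_ (hupper x hx.1)
    rw [hh, if_neg (not_le.mpr hx.2.1)]
    exact secant_le_of_mem_Rl hw hφconc hφmaj hx
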